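/- For any countable class C of value-stable environments, there exists a single policy p which is self-optimizing for C, i.e., V(ν,p) = V*_ν with probability 1 for every environment ν ∈ C. -/

import Mathlib

open MeasureTheory Filter Finset Asymptotics
open scoped ENNReal Classical

noncomputable section

namespace RL

/-- A perception `x = (r, o)`: a reward `r ∈ R = {0, …, r_max}` together with an
observation `o ∈ O`. -/
abbrev Percept (O : Type) (rmax : ℕ) := Fin (rmax + 1) × O

/-- A cycle `z = (y, r, o)`: an action together with the resulting perception. -/
abbrev Cycle (Y O : Type) (rmax : ℕ) := Y × Percept O rmax

/-- A deterministic policy maps a history `z_{<k}` to the next action `y_k`. -/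
abbrev Policy (Y O : Type) (rmax : ℕ) := List (Cycle Y O rmax) → Y

/-- An infinite interaction sequence. -/
abbrev Traj (Y O : Type) (rmax : ℕ) := ℕ → Cycle Y O rmax

instance (Y O : Type) (rmax : ℕ) : MeasurableSpace (Cycle Y O rmax) := ⊤

/-- The reward of a cycle `z = (y, (r, o))`, as a real number. -/
def rew {Y O : Type} {rmax : ℕ} (z : Cycle Y O rmax) : ℝ := ((z.2.1 : ℕ) : ℝ)

/-- The cylinder set of all infinite sequences extending the finite sequence `l`. -/
def cylSet {A : Type} (l : List A) : Set (ℕ → A) := {ω | ∀ i : Fin l.length, ω i.1 = l.get i}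

/-- An environment: conditional probabilities `ν(x_k | z_{<k} y_k)` of the next perception
given the history, together with, for each (deterministic) policy `p`, the induced
probability measure on interaction sequences, which on cylinder sets is given by the
product of the conditional probabilities (actions being forced by the policy). -/
structure Environment (Y O : Type) [Fintype Y] [Fintype O] (rmax : ℕ) where
  cond : List (Cycle Y O rmax) → Y → Percept O rmax → ℝ
  cond_nonneg : ∀ h y x, 0 ≤ cond h y x
  cond_sum_one : ∀ h y, ∑ x : Percept O rmax, cond h y x = 1
  P : Policy Y O rmax → Measure (Traj Y O rmax)
  P_prob : ∀ p, IsProbabilityMeasure (P p)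
  P_cyl : ∀ (p : Policy Y O rmax) (h : List (Cycle Y O rmax)) (z : Cycle Y O rmax),
    P p (cylSet (h ++ [z]))
      = P p (cylSet h) * ENNReal.ofReal (if z.1 = p h then cond h z.1 z.2 else 0)

variable {Y O : Type} [Fintype Y] [Fintype O] {rmax : ℕ}

/-- The average reward `(1/m) r_{1..m}` of the first `m` steps of a trajectory. -/
def avg {Y O : Type} {rmax : ℕ} (ω : Traj Y O rmax) (m : ℕ) : ℝ :=
  (∑ i ∈ Finset.range m, rew (ω i)) / m

/-- `V(ν,p) = V` : the average limiting value exists a.s. and equals the constant `V`. -/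
def ValueIs (ν : Environment Y O rmax) (p : Policy Y O rmax) (V : ℝ) : Prop :=
  ν.P p {ω | Tendsto (avg ω) atTop (nhds V)} = 1

/-- `V̄(ν,p) = V` : the upper limiting average value is a.s. the constant `V`. -/
def UpperValueIs (ν : Environment Y O rmax) (p : Policy Y O rmax) (V : ℝ) : Prop :=
  ν.P p {ω | limsup (avg ω) atTop = V} = 1

/-- `V` is the optimal value `V*_ν` of `ν`: some policy `p_ν` achieves average value `V`
a.s., and every policy has upper average value `≤ V` a.s. -/
def IsOptimalValue (ν : Environment Y O rmax) (V : ℝ) : Prop :=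
  ∃ p, ValueIs ν p V ∧ ∀ q : Policy Y O rmax, ν.P q {ω | limsup (avg ω) atTop ≤ V} = 1

/-- An environment is explorable if it has an optimal value `V*_ν`. -/
def Explorable (ν : Environment Y O rmax) : Prop := ∃ V, IsOptimalValue ν V

/-- `V` is the upper optimal value `V̄*_ν` of `ν`. -/
def IsUpperOptimalValue (ν : Environment Y O rmax) (V : ℝ) : Prop :=
  ∃ p, UpperValueIs ν p V ∧ ∀ q : Policy Y O rmax, ν.P q {ω | limsup (avg ω) atTop ≤ V} = 1

/-- An environment is upper explorable if it has an upper optimal value `V̄*_ν`. -/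
def UpperExplorable (ν : Environment Y O rmax) : Prop := ∃ V, IsUpperOptimalValue ν V

/-- `ν(x_{<k} | y_{<k})` : the probability of the perceptions of the history `h`,
given its actions. -/
def histProbX (ν : Environment Y O rmax) (h : List (Cycle Y O rmax)) : ℝ :=
  ∏ i : Fin h.length, ν.cond (h.take i.1) (h.get i).1 (h.get i).2

/-- Replace the first `k-1` actions of the policy `p` by the actions `y_{<k}` of the
history `h`. -/
def replacePolicy (h : List (Cycle Y O rmax)) (p : Policy Y O rmax) : Policy Y O rmax :=
  fun l => if hl : l.length < h.length then (h.get ⟨l.length, hl⟩).1 else p l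

/-- The measure induced by `(p, ν)` conditional on the history `h = z_{<k}`:
`ν`-probabilities conditional on `x_{<k}`, with the first `k-1` actions of `p`
replaced by `y_{<k}`. -/
def condMeasure (ν : Environment Y O rmax) (p : Policy Y O rmax)
    (h : List (Cycle Y O rmax)) : Measure (Traj Y O rmax) :=
  ProbabilityTheory.cond (ν.P (replacePolicy h p)) (cylSet h)

/-- `P( · | z_{<k})` under policy `p` in environment `ν`. -/
def condProb (ν : Environment Y O rmax) (p : Policy Y O rmax)
    (h : List (Cycle Y O rmax)) (A : Set (Traj Y O rmax)) : ℝ≥0∞ :=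
  condMeasure ν p h A

/-- `V(ν,p,z_{<k}) = V` : conditional on `z_{<k}`, the average limiting value is a.s. `V`. -/
def CondValueIs (ν : Environment Y O rmax) (p : Policy Y O rmax)
    (h : List (Cycle Y O rmax)) (V : ℝ) : Prop :=
  condProb ν p h {ω | Tendsto (avg ω) atTop (nhds V)} = 1

/-- `V̄(ν,p,z_{<k}) = V` : conditional on `z_{<k}`, the upper limiting average value
is a.s. `V`. -/
def CondUpperValueIs (ν : Environment Y O rmax) (p : Policy Y O rmax)
    (h : List (Cycle Y O rmax)) (V : ℝ) : Prop :=
  condProb ν p h {ω | limsup (avg ω) atTop = V} = 1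

/-- `V` is the conditional optimal value `V*_ν(z_{<k})`. -/
def IsCondOptimalValue (ν : Environment Y O rmax) (h : List (Cycle Y O rmax)) (V : ℝ) : Prop :=
  ∃ p, CondValueIs ν p h V ∧
    ∀ q : Policy Y O rmax, condProb ν q h {ω | limsup (avg ω) atTop ≤ V} = 1

/-- `V` is the conditional upper optimal value `V̄*_ν(z_{<k})`. -/
def IsCondUpperOptimalValue (ν : Environment Y O rmax) (h : List (Cycle Y O rmax)) (V : ℝ) :
    Prop :=
  ∃ p, CondUpperValueIs ν p h V ∧
    ∀ q : Policy Y O rmax, condProb ν q h {ω | limsup (avg ω) atTop ≤ V} = 1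

/-- Strongly explorable: after any history of positive probability there is a conditionally
optimal value. -/
def StronglyExplorable (ν : Environment Y O rmax) : Prop :=
  ∀ h, 0 < histProbX ν h → ∃ V, IsCondOptimalValue ν h V

/-- Strongly upper explorable. -/
def StronglyUpperExplorable (ν : Environment Y O rmax) : Prop :=
  ∀ h, 0 < histProbX ν h → ∃ V, IsCondUpperOptimalValue ν h V

/-- The worst-case optimal value `W*_ν = inf_{z_{<k}} V*_ν(z_{<k})`. -/
def Wstar (ν : Environment Y O rmax) : ℝ :=
  sInf {V | ∃ h, 0 < histProbX ν h ∧ IsCondOptimalValue ν h V}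

/-- The worst-case upper optimal value `W̄*_ν = inf_{z_{<k}} V̄*_ν(z_{<k})`. -/
def WstarUpper (ν : Environment Y O rmax) : ℝ :=
  sInf {V | ∃ h, 0 < histProbX ν h ∧ IsCondUpperOptimalValue ν h V}

/-- Recoverable: after any history of positive probability, some policy attains the
upper optimal value `V̄*_ν` with conditional probability 1. -/
def Recoverable (ν : Environment Y O rmax) : Prop :=
  ∃ V, IsUpperOptimalValue ν V ∧
    ∀ h, 0 < histProbX ν h →
      ∃ p, condProb ν p h {ω | limsup (avg ω) atTop = V} = 1

/-- The quantitative part of value-stability, with target value `W`: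
rewards `r_i ∈ [0, r_max]` with `(1/n) r_{1..n} → W`, `d(k,ε) = o(k)`,
`Σ_n φ(n,ε) < ∞`, and from any history `z_{<k}` some policy `p` recovers:
`P( r_{k..k+n} − r^{pν}_{k..k+n} > d(k,ε) + nε | z_{<k} ) ≤ φ(n,ε)`. -/
def ValueStableCore (ν : Environment Y O rmax) (W : ℝ) (r : ℕ → ℝ)
    (d : ℕ → ℝ → ℝ) (φ : ℕ → ℝ → ℝ) : Prop :=
  (∀ i, r i ∈ Set.Icc (0 : ℝ) (rmax : ℝ)) ∧
  Tendsto (fun n => (∑ i ∈ Finset.range n, r i) / n) atTop (nhds W) ∧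
  (∀ ε : ℝ, 0 < ε → (fun k : ℕ => d k ε) =o[atTop] fun k : ℕ => (k : ℝ)) ∧
  (∀ ε : ℝ, 0 < ε → Summable fun n => φ n ε) ∧
  ∀ h : List (Cycle Y O rmax), ∃ p : Policy Y O rmax, ∀ ε : ℝ, 0 < ε → ∀ n : ℕ,
    condProb ν p h
      {ω | d h.length ε + n * ε <
        (∑ i ∈ Finset.Icc h.length (h.length + n), r i)
          - ∑ i ∈ Finset.Icc h.length (h.length + n), rew (ω i)}
      ≤ ENNReal.ofReal (φ n ε)

/-- Value-stability with explicit witnesses `V = V*_ν`, `r`, `d`, `φ`. -/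
def ValueStableWith (ν : Environment Y O rmax) (V : ℝ) (r : ℕ → ℝ)
    (d : ℕ → ℝ → ℝ) (φ : ℕ → ℝ → ℝ) : Prop :=
  IsOptimalValue ν V ∧ ValueStableCore ν V r d φ

/-- A value-stable environment. -/
def ValueStable (ν : Environment Y O rmax) : Prop :=
  ∃ V r d φ, ValueStableWith ν V r d φ

/-- A worst-case value-stable environment: strongly explorable, and the value-stability
condition holds with target `W*_ν`. -/
def WorstCaseValueStable (ν : Environment Y O rmax) : Prop :=
  StronglyExplorable ν ∧ ∃ r d φ, ValueStableCore ν (Wstar ν) r d φ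

/-- A policy is self-optimizing for a class `C` if it attains the optimal value `V*_ν`
in every `ν ∈ C`. -/
def SelfOptimizing (p : Policy Y O rmax) (C : Set (Environment Y O rmax)) : Prop :=
  ∀ ν ∈ C, ∀ V, IsOptimalValue ν V → ValueIs ν p V

/-- A policy is upper self-optimizing for a class `C` if it attains the upper optimal
value `V̄*_ν` in every `ν ∈ C`. -/
def UpperSelfOptimizing (p : Policy Y O rmax) (C : Set (Environment Y O rmax)) : Prop :=
  ∀ ν ∈ C, ∀ V, IsUpperOptimalValue ν V → UpperValueIs ν p V

/-- A deterministic environment: all conditional probabilities are `0` or `1`. -/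
def Deterministic (ν : Environment Y O rmax) : Prop :=
  ∀ h y x, ν.cond h y x = 0 ∨ ν.cond h y x = 1

/-- In a deterministic environment, the perception following history `h` and action `y`. -/
def pick [Nonempty O] (ν : Environment Y O rmax) (h : List (Cycle Y O rmax)) (y : Y) :
    Percept O rmax :=
  if hx : ∃ x, ν.cond h y x = 1 then hx.choose else Classical.arbitrary _

/-- The (deterministic) history generated by policy `p` in a deterministic environment. -/
def detHist [Nonempty O] (ν : Environment Y O rmax) (p : Policy Y O rmax) :
    ℕ → List (Cycle Y O rmax)
  | 0 => []
  | n + 1 =>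
      detHist ν p n ++ [(p (detHist ν p n), pick ν (detHist ν p n) (p (detHist ν p n)))]

/-- The cycle `z_n` generated by policy `p` in a deterministic environment. -/
def detZ [Nonempty O] (ν : Environment Y O rmax) (p : Policy Y O rmax) (n : ℕ) :
    Cycle Y O rmax :=
  (p (detHist ν p n), pick ν (detHist ν p n) (p (detHist ν p n)))

end RL

namespace RL

theorem exists_monotone_eventually {P : ℕ → ℕ → Prop}
    (h : ∀ m, ∀ᶠ k in atTop, P m k) :
    ∃ w : ℕ → ℕ, Monotone w ∧ Tendsto w atTop atTop ∧ ∀ᶠ k in atTop, P (w k) k := by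
  obtain ⟨φ, hφ, hP⟩ := extraction_forall_of_eventually'
    (P := fun m n => ∀ k ≥ n, P m k) fun m => by
      obtain ⟨N, hN⟩ := eventually_atTop.1 (h m)
      exact ⟨N, fun n hn k hk => hN k (hn.trans hk)⟩
  refine ⟨fun k => Nat.findGreatest (fun m => φ m ≤ k) k, fun a b hab =>
    Nat.findGreatest_mono (fun m hm => le_trans hm hab) hab, ?_, ?_⟩
  · refine tendsto_atTop.2 fun m => ?_
    filter_upwards [eventually_ge_atTop (φ m)] with k hk
    exact Nat.le_findGreatest ((hφ.id_le m).trans hk) hk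
  · filter_upwards [eventually_ge_atTop (φ 0)] with k hk
    exact hP _ _ (Nat.findGreatest_spec (P := fun m => φ m ≤ k) (Nat.zero_le k) hk)

/-- Countably many null sequences can be slowed down simultaneously. -/
theorem exists_monotone_mul_tendsto_zero (a : ℕ → ℕ → ℝ)
    (h : ∀ i, Tendsto (a i) atTop (nhds 0)) :
    ∃ w : ℕ → ℕ, Monotone w ∧ Tendsto w atTop atTop ∧
      ∀ i, Tendsto (fun k => a i k * ((w k : ℝ) + 1) ^ 2) atTop (nhds 0) := by
  obtain ⟨w, hmono, hw, hP⟩ := exists_monotone_eventually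
    (P := fun m k => ∀ i ∈ Finset.range (m + 1), |a i k| ≤ 1 / ((m : ℝ) + 1) ^ 3) fun m => by
      rw [Finset.eventually_all]
      intro i _
      have := (h i).abs
      rw [abs_zero] at this
      exact (this.eventually_lt_const (by positivity)).mono fun _ hk => hk.le
  refine ⟨w, hmono, hw, fun i => ?_⟩
  have hlim : Tendsto (fun k => 1 / ((w k : ℝ) + 1)) atTop (nhds 0) :=
    tendsto_one_div_add_atTop_nhds_zero_nat.comp hw
  refine squeeze_zero_norm' ?_ hlim
  filter_upwards [hP, hw.eventually_ge_atTop i] with k hk hik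
  have h1 := hk i (Finset.mem_range.2 (by omega))
  have hpos : (0 : ℝ) < (w k : ℝ) + 1 := by positivity
  rw [Real.norm_eq_abs, abs_mul, abs_of_pos (pow_pos hpos 2)]
  calc |a i k| * ((w k : ℝ) + 1) ^ 2 ≤ 1 / ((w k : ℝ) + 1) ^ 3 * ((w k : ℝ) + 1) ^ 2 := by gcongr
    _ = 1 / ((w k : ℝ) + 1) := by field_simp

/-- A scale `g = o(k)` with increments in `[0, 1]` dominating countably many sequences `o(k)`. -/
theorem exists_sublinear_dominating (D : ℕ → ℕ → ℝ)
    (h : ∀ i, Tendsto (fun k => D i k / k) atTop (nhds 0)) :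
    ∃ g : ℕ → ℝ, (∀ k, 0 ≤ g k) ∧ Monotone g ∧ (∀ k n, g (k + n) ≤ g k + n) ∧
      Tendsto (fun k => g k / k) atTop (nhds 0) ∧
      ∀ i, ∀ ε : ℝ, 0 < ε → ∀ᶠ k in atTop, |D i k| ≤ ε * g k := by
  obtain ⟨w, hmono, hw, ha⟩ := exists_monotone_mul_tendsto_zero _ h
  have hlim : Tendsto (fun k => 1 / ((w k : ℝ) + 1)) atTop (nhds 0) :=
    tendsto_one_div_add_atTop_nhds_zero_nat.comp hw
  refine ⟨fun k => ∑ l ∈ range k, 1 / ((w l : ℝ) + 1), fun k => by positivity,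
    monotone_nat_of_le_succ fun k => ?_, fun k n => ?_, ?_, fun i ε hε => ?_⟩
  · rw [Finset.sum_range_succ]
    have : (0 : ℝ) ≤ 1 / ((w k : ℝ) + 1) := by positivity
    linarith
  · induction n with
    | zero => simp
    | succ n ih =>
      beta_reduce at ih ⊢
      rw [← add_assoc, Finset.sum_range_succ]
      have : 1 / ((w (k + n) : ℝ) + 1) ≤ 1 :=
        (div_le_one (by positivity)).2 (by linarith [Nat.cast_nonneg (α := ℝ) (w (k + n))])
      push_cast
      linarith
  · simpa [div_eq_inv_mul] using hlim.cesaro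
  · have hev := ((ha i).abs.eventually_lt_const (u := ε) (by simpa using hε))
    filter_upwards [hev, eventually_gt_atTop 0] with k hk hk0
    have hpos : (0 : ℝ) < (w k : ℝ) + 1 := by positivity
    have hkpos : (0 : ℝ) < k := by exact_mod_cast hk0
    have hg : (k : ℝ) * (1 / ((w k : ℝ) + 1)) ≤ ∑ l ∈ range k, 1 / ((w l : ℝ) + 1) := by
      have := Finset.card_nsmul_le_sum (range k) (fun l => 1 / ((w l : ℝ) + 1))
        (1 / ((w k : ℝ) + 1)) fun l hl => by
          have : w l ≤ w k := hmono (Finset.mem_range.1 hl).le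
          gcongr
      simpa using this
    have h1 : |D i k| * ((w k : ℝ) + 1) ≤ ε * k := by
      rw [abs_mul, abs_div, abs_of_pos hkpos, abs_of_pos (pow_pos hpos 2)] at hk
      have h2 : |D i k| * ((w k : ℝ) + 1) ^ 2 ≤ ε * k := by
        rw [div_mul_eq_mul_div, div_lt_iff₀ hkpos] at hk
        exact hk.le
      refine le_trans ?_ h2
      gcongr
      nlinarith [Nat.cast_nonneg (α := ℝ) (w k)]
    calc |D i k| = |D i k| * ((w k : ℝ) + 1) * (1 / ((w k : ℝ) + 1)) := by field_simp
      _ ≤ ε * k * (1 / ((w k : ℝ) + 1)) := by gcongr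
      _ = ε * (k * (1 / ((w k : ℝ) + 1))) := by ring
      _ ≤ _ := by gcongr

/-- Phases `[t s, t s + N s]` of strictly increasing, sublinear length which nevertheless
dominate countably many sequences `o(k)` at both ends of the phase. -/
theorem exists_schedule (D : ℕ → ℕ → ℝ)
    (h : ∀ i, Tendsto (fun k => D i k / k) atTop (nhds 0)) :
    ∃ t N : ℕ → ℕ, t 0 = 0 ∧ (∀ s, t (s + 1) = t s + N s + 1) ∧ StrictMono N ∧
      Tendsto (fun s => ((N s : ℝ) + 1) / t s) atTop (nhds 0) ∧
      ∀ i, ∀ ε : ℝ, 0 < ε → ∀ᶠ s in atTop,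
        |D i (t s)| ≤ ε * (N s + 1) ∧ |D i (t (s + 1))| ≤ ε * (N s + 1) := by
  obtain ⟨g, hg0, hgm, hginc, hglim, hgD⟩ := exists_sublinear_dominating D h
  obtain ⟨t, ht0, ht'⟩ : ∃ t : ℕ → ℕ, t 0 = 0 ∧ ∀ s, t (s + 1) = t s + (s + ⌈g (t s)⌉₊) + 1 :=
    ⟨fun s => Nat.rec (motive := fun _ => ℕ) 0 (fun s u => u + (s + ⌈g u⌉₊) + 1) s, rfl,
      fun _ => rfl⟩
  obtain ⟨N, hN⟩ : ∃ N : ℕ → ℕ, ∀ s, N s = s + ⌈g (t s)⌉₊ := ⟨_, fun _ => rfl⟩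
  have ht : ∀ s, t (s + 1) = t s + N s + 1 := fun s => by rw [ht', hN]
  have htm : StrictMono t := strictMono_nat_of_lt_succ fun s => by rw [ht]; omega
  have htop : Tendsto t atTop atTop := htm.tendsto_atTop
  have hsq : ∀ s : ℕ, (s : ℝ) ^ 2 ≤ 2 * t s := by
    intro s
    induction s with
    | zero => simp [ht0]
    | succ s ih =>
      have h1 : s ≤ N s := by rw [hN]; omega
      have h2 : (s : ℝ) ≤ N s := by exact_mod_cast h1
      rw [ht]
      push_cast
      nlinarith
  have hNg : ∀ s, g (t s) ≤ N s := fun s => by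
    have := Nat.le_ceil (g (t s))
    rw [hN]
    push_cast
    linarith [Nat.cast_nonneg (α := ℝ) s]
  refine ⟨t, N, ht0, ht, fun a b hab => ?_, ?_, fun i ε hε => ?_⟩
  · rw [hN, hN]
    exact add_lt_add_of_lt_of_le hab (Nat.ceil_mono (hgm (htm.monotone hab.le)))
  · have hlim : Tendsto (fun s : ℕ => 6 / (s : ℝ) + g (t s) / t s) atTop (nhds 0) := by
      simpa using (tendsto_const_div_atTop_nhds_zero_nat 6).add (hglim.comp htop)
    refine squeeze_zero' (Eventually.of_forall fun s => by positivity) ?_ hlim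
    filter_upwards [eventually_gt_atTop 0] with s hs
    have hs1 : (1 : ℝ) ≤ s := by exact_mod_cast hs
    have hts : (0 : ℝ) < t s := by nlinarith [hsq s]
    have h1 := (Nat.ceil_lt_add_one (hg0 (t s))).le
    have h2 : (N s : ℝ) + 1 ≤ 3 * s + g (t s) := by
      rw [hN]
      push_cast
      linarith
    have h3 : 3 * (s : ℝ) / t s ≤ 6 / s := by
      rw [div_le_div_iff₀ hts (by linarith)]
      nlinarith [hsq s]
    calc ((N s : ℝ) + 1) / t s ≤ (3 * s + g (t s)) / t s := by gcongr
      _ = 3 * s / t s + g (t s) / t s := add_div _ _ _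
      _ ≤ _ := by gcongr
  · have hev := hgD i (ε / 2) (by positivity)
    filter_upwards [htop.eventually hev,
      (htop.comp (tendsto_add_atTop_nat 1)).eventually hev] with s h1 h2
    have h3 := hNg s
    have h4 : g (t (s + 1)) ≤ 2 * (N s + 1) := by
      have := hginc (t s) (N s + 1)
      rw [ht, add_assoc]
      push_cast at this
      linarith
    constructor
    · nlinarith [hg0 (t s)]
    · have h5 : |D i (t (s + 1))| ≤ ε / 2 * g (t (s + 1)) := h2
      nlinarith

theorem exists_rate {ρ : ℕ → ℝ} (h : Tendsto ρ atTop (nhds 0)) :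
    ∃ w : ℕ → ℕ, Monotone w ∧ Tendsto w atTop atTop ∧
      Tendsto (fun k => ρ k * ((w k : ℝ) + 1) ^ 2) atTop (nhds 0) := by
  obtain ⟨w, h1, h2, h3⟩ := exists_monotone_mul_tendsto_zero (fun _ => ρ) fun _ => h
  exact ⟨w, h1, h2, h3 0⟩

theorem sum_range_add_sum_Icc (f : ℕ → ℝ) (a n : ℕ) :
    ∑ i ∈ range a, f i + ∑ i ∈ Finset.Icc a (a + n), f i = ∑ i ∈ range (a + n + 1), f i := by
  have h : Finset.Icc a (a + n) = Finset.Ico a (a + n + 1) := by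
    ext i
    simp only [Finset.mem_Icc, Finset.mem_Ico]
    omega
  rw [h, Finset.sum_range_add_sum_Ico _ (by omega)]

/-- The index `s` of the phase `[t s, t (s + 1))` containing `k`. -/
noncomputable def phaseIndex (t : ℕ → ℕ) (k : ℕ) : ℕ := Nat.findGreatest (fun s => t s ≤ k) k

theorem phaseIndex_eq {t : ℕ → ℕ} (ht : StrictMono t) {k s : ℕ} (h1 : t s ≤ k)
    (h2 : k < t (s + 1)) : phaseIndex t k = s :=
  Nat.findGreatest_eq_iff.2 ⟨(ht.id_le s).trans h1, fun _ => h1, fun _ hn _ h =>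
    absurd (h2.trans_le ((ht.monotone hn).trans h)) (lt_irrefl k)⟩

theorem phaseIndex_le {t : ℕ → ℕ} (h0 : t 0 = 0) (k : ℕ) : t (phaseIndex t k) ≤ k :=
  Nat.findGreatest_spec (P := fun s => t s ≤ k) (Nat.zero_le k) (by omega)

theorem lt_phaseIndex_succ {t : ℕ → ℕ} (ht : StrictMono t) (k : ℕ) :
    k < t (phaseIndex t k + 1) := by
  by_contra! h
  have := Nat.le_findGreatest (P := fun s => t s ≤ k) ((ht.id_le _).trans h) h
  exact absurd this (Nat.not_succ_le_self _)

theorem tendsto_phaseIndex {t : ℕ → ℕ} (ht : StrictMono t) :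
    Tendsto (phaseIndex t) atTop atTop :=
  tendsto_atTop.2 fun s => (eventually_ge_atTop (t s)).mono fun _ hk =>
    Nat.le_findGreatest ((ht.id_le s).trans hk) hk

/-- The recursion of the failure counts `c` along a sequence `e` of selected experts. -/
def IsFailureCount (e : ℕ → ℕ) (fail : ℕ → Prop) (c : ℕ → ℕ → ℕ) : Prop :=
  ∀ s i, c (s + 1) i = c s i + if i = e s ∧ fail s then 1 else 0

section FailureCount

variable {e : ℕ → ℕ} {fail : ℕ → Prop} {c : ℕ → ℕ → ℕ}

theorem IsFailureCount.monotone (hc : IsFailureCount e fail c) (i : ℕ) :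
    Monotone fun s => c s i :=
  monotone_nat_of_le_succ fun s => by rw [hc]; exact Nat.le_add_right _ _

theorem IsFailureCount.exists_bound (hc : IsFailureCount e fail c) {j : ℕ}
    (hj : ∀ᶠ s in atTop, e s = j → ¬ fail s) : ∃ M, ∀ s, c s j ≤ M := by
  obtain ⟨S, hS⟩ := eventually_atTop.1 hj
  refine ⟨c S j, fun s => ?_⟩
  rcases le_total s S with h | h
  · exact hc.monotone j h
  · induction s, h using Nat.le_induction with
    | base => exact le_rfl
    | succ s hs ih =>
      rw [hc, if_neg fun h => hS s hs h.1.symm h.2]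
      exact ih

/-- If every selected expert has small index and few failures, there are few failures. -/
theorem IsFailureCount.card_le (hc : IsFailureCount e fail c) {S L : ℕ}
    (hL : ∀ s < S, c s (e s) + e s ≤ L) :
    #{s ∈ range S | fail s} ≤ (L + 1) ^ 2 := by
  have hcard : #(range (L + 1) ×ˢ range (L + 1)) = (L + 1) ^ 2 := by simp [sq]
  rw [← hcard]
  refine Finset.card_le_card_of_injOn (fun s => (e s, c s (e s))) (fun s hs => ?_) ?_
  · have := hL s (by simpa using (Finset.mem_filter.1 hs).1)
    simp only [Finset.coe_product, Finset.coe_range, Set.mem_prod, Set.mem_Iio]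
    omega
  · have key : ∀ a b, fail a → a < b → e a = e b → c a (e a) ≠ c b (e b) := by
      intro a b ha hab he h
      have h1 := hc.monotone (e a) (Nat.succ_le_of_lt hab)
      have h2 := hc a (e a)
      rw [if_pos ⟨rfl, ha⟩] at h2
      simp only [Nat.succ_eq_add_one] at h1
      rw [← he] at h
      omega
    intro a ha b hb hab
    simp only [Prod.mk.injEq] at hab
    rcases lt_trichotomy a b with h | h | h
    · exact absurd hab.2 (key a b (Finset.mem_filter.1 ha).2 h hab.1)
    · exact h
    · exact absurd hab.2.symm (key b a (Finset.mem_filter.1 hb).2 h hab.1.symm)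

end FailureCount

/-- Optimistic selection of experts with slowly vanishing penalty `1 / (w + 1)` for past failures
attains on average at least the promise `U j` of each expert `j` that fails finitely often. -/
theorem eventually_le_sum_of_optimistic {t N w : ℕ → ℕ} (ht0 : t 0 = 0)
    (ht : ∀ s, t (s + 1) = t s + N s + 1) (hN : StrictMono N) (hw : Monotone w)
    (hw' : Tendsto w atTop atTop)
    (hrate : Tendsto (fun s => ((N s : ℝ) + 1) / t s * ((w s : ℝ) + 1) ^ 2) atTop (nhds 0))
    {R : ℕ} {U : ℕ → ℝ} (hU : ∀ i, U i ≤ R) (hU' : ∀ i, -1 ≤ U i)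
    {x : ℕ → ℝ} (hx : ∀ i, 0 ≤ x i) {e : ℕ → ℕ} {c : ℕ → ℕ → ℕ}
    (hc : IsFailureCount e
      (fun s => ∑ i ∈ Finset.Icc (t s) (t s + N s), x i < ((N s : ℝ) + 1) * U (e s)) c)
    (he : ∀ s i, U i - ((c s i : ℝ) + i) / ((w s : ℝ) + 1)
      ≤ U (e s) - ((c s (e s) : ℝ) + e s) / ((w s : ℝ) + 1) + 1 / ((w s : ℝ) + 1))
    {j : ℕ} (hj : ∀ᶠ s in atTop, e s = j →
      ¬ ∑ i ∈ Finset.Icc (t s) (t s + N s), x i < ((N s : ℝ) + 1) * U (e s))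
    {η : ℝ} (hη : 0 < η) :
    ∀ᶠ m : ℕ in atTop, (U j - 3 * η) * m ≤ ∑ i ∈ range m, x i := by
  have htm : StrictMono t := strictMono_nat_of_lt_succ fun s => by rw [ht]; omega
  obtain ⟨M, hM⟩ := hc.exists_bound hj
  set fail : ℕ → Prop :=
    fun s => ∑ i ∈ Finset.Icc (t s) (t s + N s), x i < ((N s : ℝ) + 1) * U (e s)
  have hwpos : ∀ s, (0 : ℝ) < (w s : ℝ) + 1 := fun s => by positivity
  have hcM : ∀ s, (c s j : ℝ) ≤ M := fun s => by exact_mod_cast hM s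
  have hscore : ∀ s, (U j - U (e s)) * ((w s : ℝ) + 1) + c s (e s) + e s ≤ M + j + 1 := by
    intro s
    have h1 := he s j
    have h2 := hcM s
    have h3 : U j - U (e s) ≤ ((c s j : ℝ) + j + 1 - (c s (e s) + e s)) / ((w s : ℝ) + 1) := by
      rw [sub_div, add_div _ (1 : ℝ)]
      linarith
    rw [le_div_iff₀ (hwpos s)] at h3
    linarith
  have hfew : ∀ S, #{s ∈ range S | fail s} ≤ ((R + 1 + (M + j + 1)) * (w S + 1) + 1) ^ 2 := by
    refine fun S => hc.card_le fun s hs => ?_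
    have h1 : c s (e s) + e s ≤ (R + 1) * (w s + 1) + (M + j + 1) := by
      have := hscore s
      have h2 : (-(R + 1) : ℝ) * ((w s : ℝ) + 1) ≤ (U j - U (e s)) * ((w s : ℝ) + 1) := by
        gcongr
        linarith [hU (e s), hU' j]
      have h3 : (c s (e s) : ℝ) + e s ≤ (R + 1) * (w s + 1) + (M + j + 1) := by linarith
      exact_mod_cast h3
    have h2 : w s ≤ w S := hw hs.le
    nlinarith
  obtain ⟨B, hB⟩ : ∃ B : ℝ, B = ((R : ℝ) + 1 + (M + j + 1) + 1) ^ 2 := ⟨_, rfl⟩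
  have hB0 : 0 ≤ B := by rw [hB]; positivity
  have hfew' : ∀ S, (#{s ∈ range S | fail s} : ℝ) ≤ B * ((w S : ℝ) + 1) ^ 2 := by
    intro S
    have h1 : (#{s ∈ range S | fail s} : ℝ)
        ≤ (((R : ℝ) + 1 + (M + j + 1)) * ((w S : ℝ) + 1) + 1) ^ 2 := by exact_mod_cast hfew S
    refine h1.trans ?_
    rw [hB, ← mul_pow]
    gcongr
    linarith [Nat.cast_nonneg (α := ℝ) (w S)]
  have hphase : ∀ s, ∑ i ∈ range (t (s + 1)), x i
      = ∑ i ∈ range (t s), x i + ∑ i ∈ Finset.Icc (t s) (t s + N s), x i := by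
    intro s
    rw [ht, sum_range_add_sum_Icc]
  have hcost : ∀ S, ∑ s ∈ range S with fail s, ((N s : ℝ) + 1)
      ≤ B * (((N S : ℝ) + 1) * ((w S : ℝ) + 1) ^ 2) := by
    intro S
    have h1 : ∑ s ∈ range S with fail s, ((N s : ℝ) + 1)
        ≤ #{s ∈ range S | fail s} • ((N S : ℝ) + 1) := by
      refine Finset.sum_le_card_nsmul _ _ _ fun s hs => ?_
      have : N s ≤ N S := hN.monotone (Finset.mem_range.1 (Finset.mem_filter.1 hs).1).le
      gcongr
    rw [nsmul_eq_mul] at h1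
    calc _ ≤ _ := h1
      _ ≤ B * ((w S : ℝ) + 1) ^ 2 * ((N S : ℝ) + 1) := by gcongr; exact hfew' S
      _ = _ := by ring
  obtain ⟨S₀, hS₀⟩ := eventually_atTop.1 ((tendsto_natCast_atTop_atTop.comp hw').eventually_ge_atTop
    (((M : ℝ) + j + 1) / η))
  have hopt : ∀ s ≥ S₀, U j - η ≤ U (e s) := by
    intro s hs
    have h1 : ((M : ℝ) + j + 1) / η ≤ w s := hS₀ s hs
    rw [div_le_iff₀ hη] at h1
    have h2 := hscore s
    by_contra! h3
    have h4 : η * ((w s : ℝ) + 1) ≤ (U j - U (e s)) * ((w s : ℝ) + 1) := by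
      gcongr
      linarith
    have h5 : (0 : ℝ) ≤ (c s (e s) : ℝ) + e s := by positivity
    nlinarith
  have hmain : ∀ S ≥ S₀, (U j - η) * ((t S : ℝ) - t S₀)
      - R * ∑ s ∈ range S with fail s, ((N s : ℝ) + 1) ≤ ∑ i ∈ range (t S), x i := by
    intro S hS
    induction S, hS using Nat.le_induction with
    | base =>
      have h1 : 0 ≤ ∑ i ∈ range (t S₀), x i := Finset.sum_nonneg fun i _ => hx i
      have h2 : 0 ≤ (R : ℝ) * ∑ s ∈ range S₀ with fail s, ((N s : ℝ) + 1) := by positivity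
      linarith
    | succ S hS ih =>
      rw [hphase, Finset.range_add_one, Finset.filter_insert]
      have hT : (t (S + 1) : ℝ) = t S + (N S + 1) := by rw [ht]; push_cast; ring
      have h1 := hopt S hS
      have hNpos : (0 : ℝ) < (N S : ℝ) + 1 := by positivity
      by_cases hf : fail S
      · rw [if_pos hf, Finset.sum_insert (by simp), hT]
        have h2 : 0 ≤ ∑ i ∈ Finset.Icc (t S) (t S + N S), x i := Finset.sum_nonneg fun i _ => hx i
        have h3 : (U j - η) * ((N S : ℝ) + 1) ≤ R * ((N S : ℝ) + 1) := by
          gcongr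
          linarith [hU j]
        linarith
      · rw [if_neg hf, hT]
        have h2 : ((N S : ℝ) + 1) * U (e S) ≤ _ := not_lt.1 hf
        have h3 : (U j - η) * ((N S : ℝ) + 1) ≤ U (e S) * ((N S : ℝ) + 1) := by gcongr
        linarith
  have hsmall : ∀ᶠ S in atTop,
      (R + R * B) * (((N S : ℝ) + 1) * ((w S : ℝ) + 1) ^ 2) ≤ η * t S ∧ S₀ ≤ S := by
    have h1 := hrate.const_mul ((R : ℝ) + R * B)
    rw [mul_zero] at h1
    filter_upwards [h1.eventually_lt_const hη, eventually_ge_atTop S₀,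
      eventually_gt_atTop 0] with S h2 h3 h4
    have htS : (0 : ℝ) < t S := by exact_mod_cast h4.trans_le (htm.id_le S)
    refine ⟨?_, h3⟩
    rw [div_mul_eq_mul_div, mul_div_assoc', div_lt_iff₀ htS] at h2
    exact h2.le
  have hstart : ∀ᶠ m : ℕ in atTop, (R : ℝ) * t S₀ ≤ η * m :=
    (tendsto_natCast_atTop_atTop.const_mul_atTop hη).eventually_ge_atTop _
  filter_upwards [(tendsto_phaseIndex htm).eventually hsmall, hstart] with m ⟨h1, h2⟩ h3
  set S := phaseIndex t m
  have h4 : t S ≤ m := phaseIndex_le ht0 m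
  have h5 : m < t (S + 1) := lt_phaseIndex_succ htm m
  have h4' : (t S : ℝ) ≤ m := by exact_mod_cast h4
  have h5' : (m : ℝ) ≤ t S + (N S + 1) := by rw [ht] at h5; exact_mod_cast h5.le
  have h6 : ∑ i ∈ range (t S), x i ≤ ∑ i ∈ range m, x i :=
    Finset.sum_le_sum_of_subset_of_nonneg (Finset.range_mono h4) fun i _ _ => hx i
  have h7 := hmain S h2
  have hb : U j - η ≤ R := by linarith [hU j]
  have h8 : (U j - η) * (m - t S + t S₀) ≤ R * ((N S + 1) + t S₀) := by
    calc (U j - η) * (m - t S + t S₀) ≤ R * (m - t S + t S₀) := by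
          gcongr
      _ ≤ _ := by gcongr; linarith
  have h9 : (R : ℝ) * (N S + 1) ≤ R * (((N S : ℝ) + 1) * ((w S : ℝ) + 1) ^ 2) := by
    gcongr
    refine le_mul_of_one_le_right (by positivity) (one_le_pow₀ ?_)
    linarith [Nat.cast_nonneg (α := ℝ) (w S)]
  have h10 : (R : ℝ) * ∑ s ∈ range S with fail s, ((N s : ℝ) + 1)
      ≤ R * (B * (((N S : ℝ) + 1) * ((w S : ℝ) + 1) ^ 2)) := by gcongr; exact hcost S
  have h11 : η * t S ≤ η * m := by gcongr
  nlinarith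

section Prefix

/-- The list of the first `k` terms of a sequence. -/
def pre {A : Type} (ω : ℕ → A) (k : ℕ) : List A := (List.range k).map ω

variable {A : Type}

@[simp] theorem length_pre (ω : ℕ → A) (k : ℕ) : (pre ω k).length = k := by simp [pre]

theorem pre_succ (ω : ℕ → A) (k : ℕ) : pre ω (k + 1) = pre ω k ++ [ω k] := by
  simp [pre, List.range_succ]

theorem take_pre (ω : ℕ → A) {i k : ℕ} (h : i ≤ k) : (pre ω k).take i = pre ω i := by
  simp [pre, ← List.map_take, List.take_range, h]

theorem getD_pre (ω : ℕ → A) {i k : ℕ} (h : i < k) (z : A) : (pre ω k).getD i z = ω i := by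
  simp [pre, List.getD, h]

theorem pre_congr {ω ω' : ℕ → A} {k : ℕ} (h : ∀ i < k, ω i = ω' i) : pre ω k = pre ω' k :=
  List.map_congr_left fun i hi => h i (List.mem_range.1 hi)

theorem mem_cylSet_pre {ω ω' : ℕ → A} {k : ℕ} :
    ω' ∈ cylSet (pre ω k) ↔ ∀ i < k, ω' i = ω i := by
  constructor
  · intro h i hi
    simpa [pre] using h ⟨i, by simpa using hi⟩
  · intro h i
    rw [h i.1 (by simpa using i.2), List.get_eq_getElem]
    simp [pre]

end Prefix

section Cylinder

variable {Y O : Type} {rmax : ℕ}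

/-- The first `k` cycles of a trajectory. -/
def initial (k : ℕ) (ω : Traj Y O rmax) : Fin k → Cycle Y O rmax := fun i => ω i

theorem initial_preimage_eq_cylSet (ω : Traj Y O rmax) (k : ℕ) :
    initial k ⁻¹' {initial k ω} = cylSet (pre ω k) := by
  ext ω'
  rw [mem_cylSet_pre, Set.mem_preimage, Set.mem_singleton_iff, funext_iff]
  exact ⟨fun h i hi => h ⟨i, hi⟩, fun h i => h i i.2⟩

theorem measurableSet_cylSet (h : List (Cycle Y O rmax)) :
    MeasurableSet (cylSet h : Set (Traj Y O rmax)) := by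
  have : (cylSet h : Set (Traj Y O rmax))
      = ⋂ i : Fin h.length, (fun ω : Traj Y O rmax => ω i.1) ⁻¹' {h.get i} := by
    ext ω
    simp [cylSet]
  rw [this]
  exact MeasurableSet.iInter fun i => measurable_pi_apply i.1 MeasurableSpace.measurableSet_top

theorem measurableSet_initial_preimage (k : ℕ) (v : Fin k → Cycle Y O rmax) :
    MeasurableSet (initial k ⁻¹' {v}) := by
  by_cases h : ∃ ω, initial k ω = v
  · obtain ⟨ω, rfl⟩ := h
    rw [initial_preimage_eq_cylSet]
    exact measurableSet_cylSet _
  · convert MeasurableSet.empty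
    ext ω
    simpa using fun hω => h ⟨ω, hω⟩

theorem replacePolicy_pre_of_lt (p : Policy Y O rmax) (ω : Traj Y O rmax) {i k : ℕ}
    (h : i < k) : replacePolicy (pre ω k) p (pre ω i) = (ω i).1 := by
  simp [replacePolicy, h, pre]

theorem replacePolicy_of_le {p : Policy Y O rmax} {h l : List (Cycle Y O rmax)}
    (hl : h.length ≤ l.length) : replacePolicy h p l = p l := by
  simp [replacePolicy, hl.not_gt]

variable [Fintype Y] [Fintype O]

/-- Measures agreeing on the cylinders of length `k` inside an event determined by the first `k`
cycles agree on that event. -/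
theorem measure_eq_of_cylSet_eq {μ μ' : Measure (Traj Y O rmax)} {k : ℕ}
    {A : Set (Traj Y O rmax)}
    (hA : ∀ ω ω' : Traj Y O rmax, (∀ i < k, ω i = ω' i) → ω ∈ A → ω' ∈ A)
    (h : ∀ ω ∈ A, μ (cylSet (pre ω k)) = μ' (cylSet (pre ω k))) : μ A = μ' A := by
  have hpre : A = initial k ⁻¹' ↑(initial k '' A).toFinset := by
    ext ω
    rw [Set.coe_toFinset]
    constructor
    · exact fun hω => ⟨ω, hω, rfl⟩
    · rintro ⟨ω', hω', he⟩
      exact hA ω' ω (fun i hi => congrFun he ⟨i, hi⟩) hω'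
  rw [hpre, ← sum_measure_preimage_singleton _ fun v _ => measurableSet_initial_preimage k v,
    ← sum_measure_preimage_singleton _ fun v _ => measurableSet_initial_preimage k v]
  refine Finset.sum_congr rfl fun v hv => ?_
  obtain ⟨ω, hω, rfl⟩ := Set.mem_toFinset.1 hv
  rw [initial_preimage_eq_cylSet]
  exact h ω hω

theorem measure_le_of_cylSet_le {μ : Measure (Traj Y O rmax)} [IsProbabilityMeasure μ] {k : ℕ}
    {A : Set (Traj Y O rmax)} {c : ℝ≥0∞}
    (h : ∀ ω, μ (cylSet (pre ω k) ∩ A) ≤ μ (cylSet (pre ω k)) * c) : μ A ≤ c := by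
  have hcover : A ⊆ ⋃ v, initial k ⁻¹' {v} ∩ A :=
    fun ω hω => Set.mem_iUnion.2 ⟨initial k ω, rfl, hω⟩
  have hle : ∀ v, μ (initial k ⁻¹' {v} ∩ A) ≤ μ (initial k ⁻¹' {v}) * c := by
    intro v
    by_cases hv : ∃ ω, initial k ω = v
    · obtain ⟨ω, rfl⟩ := hv
      rw [initial_preimage_eq_cylSet]
      exact h ω
    · have : initial k ⁻¹' {v} = ∅ := by
        ext ω
        simpa using fun hω => hv ⟨ω, hω⟩
      simp [this]
  have hsum : ∑ v, μ (initial k ⁻¹' {v}) = 1 := by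
    rw [sum_measure_preimage_singleton _ fun v _ => measurableSet_initial_preimage k v]
    simp
  calc μ A ≤ μ (⋃ v, initial k ⁻¹' {v} ∩ A) := measure_mono hcover
    _ ≤ ∑ v, μ (initial k ⁻¹' {v} ∩ A) := measure_iUnion_fintype_le _ _
    _ ≤ ∑ v, μ (initial k ⁻¹' {v}) * c := Finset.sum_le_sum fun v _ => hle v
    _ = c := by rw [← Finset.sum_mul, hsum, one_mul]

theorem P_cylSet_pre_congr (ν : Environment Y O rmax) {p q : Policy Y O rmax}
    {ω : Traj Y O rmax} {k : ℕ} (h : ∀ i < k, p (pre ω i) = q (pre ω i)) :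
    ν.P p (cylSet (pre ω k)) = ν.P q (cylSet (pre ω k)) := by
  induction k with
  | zero =>
    have h1 : cylSet (pre ω 0) = Set.univ := by ext; simp [mem_cylSet_pre]
    have := ν.P_prob p
    have := ν.P_prob q
    rw [h1, measure_univ, measure_univ]
  | succ k ih =>
    rw [pre_succ, ν.P_cyl, ν.P_cyl, ih fun i hi => h i (hi.trans k.lt_succ_self),
      h k k.lt_succ_self]

theorem action_eq_of_P_cylSet_ne_zero (ν : Environment Y O rmax) {p : Policy Y O rmax}
    {ω : Traj Y O rmax} {k : ℕ} (h : ν.P p (cylSet (pre ω k)) ≠ 0) :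
    ∀ i < k, (ω i).1 = p (pre ω i) := by
  induction k with
  | zero => simp
  | succ k ih =>
    rw [pre_succ, ν.P_cyl] at h
    intro i hi
    rcases Nat.lt_succ_iff_lt_or_eq.1 hi with hi | rfl
    · exact ih (left_ne_zero_of_mul h) i hi
    · by_contra hne
      simp [hne] at h

/-- Following `q` after the history `z_{<k}`, events up to time `n` have the probability prescribed
by `condProb`. -/
theorem P_cylSet_inter_eq (ν : Environment Y O rmax) {p q : Policy Y O rmax}
    {ω : Traj Y O rmax} {k n : ℕ} (hkn : k ≤ n) {B : Set (Traj Y O rmax)}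
    (hB : ∀ ω ω' : Traj Y O rmax, (∀ i < n, ω i = ω' i) → ω ∈ B → ω' ∈ B)
    (hpq : ∀ ω' ∈ cylSet (pre ω k), ∀ i, k ≤ i → i < n → p (pre ω' i) = q (pre ω' i)) :
    ν.P p (cylSet (pre ω k) ∩ B)
      = ν.P p (cylSet (pre ω k)) * condProb ν q (pre ω k) B := by
  have := ν.P_prob (replacePolicy (pre ω k) q)
  by_cases h0 : ν.P p (cylSet (pre ω k)) = 0
  · rw [h0, zero_mul]
    exact measure_mono_null Set.inter_subset_left h0
  have hact := action_eq_of_P_cylSet_ne_zero ν h0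
  have hpast : ∀ i < k, p (pre ω i) = replacePolicy (pre ω k) q (pre ω i) := fun i hi => by
    rw [replacePolicy_pre_of_lt _ _ hi, hact i hi]
  have hinter : ν.P p (cylSet (pre ω k) ∩ B)
      = ν.P (replacePolicy (pre ω k) q) (cylSet (pre ω k) ∩ B) := by
    refine measure_eq_of_cylSet_eq (k := n) ?_ ?_
    · rintro ω₁ ω₂ h ⟨h1, h2⟩
      refine ⟨mem_cylSet_pre.2 fun i hi => ?_, hB _ _ h h2⟩
      rw [← h i (hi.trans_le hkn)]
      exact mem_cylSet_pre.1 h1 i hi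
    · rintro ω' ⟨h1, -⟩
      refine P_cylSet_pre_congr ν fun i hi => ?_
      rcases lt_or_ge i k with hik | hik
      · rw [pre_congr fun j hj => mem_cylSet_pre.1 h1 j (hj.trans hik)]
        exact hpast i hik
      · rw [replacePolicy_of_le (by simpa using hik)]
        exact hpq ω' h1 i hik hi
  rw [hinter, P_cylSet_pre_congr ν hpast, condProb, condMeasure, mul_comm,
    ProbabilityTheory.cond_mul_eq_inter (measurableSet_cylSet _)]

end Cylinder

section PhasePolicy

variable {Y O : Type} {rmax : ℕ} [Nonempty Y] [Nonempty O]

/-- An arbitrary infinite extension of a history. -/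
def extend (l : List (Cycle Y O rmax)) : Traj Y O rmax := fun i => l.getD i (Classical.arbitrary _)

/-- In the phase `s` starting at time `t s` with history `h`, follow the policy `Q e h` of the
expert `e = sel s` selected from the history. -/
def phasePolicy (t : ℕ → ℕ) (sel : ℕ → Traj Y O rmax → ℕ)
    (Q : ℕ → List (Cycle Y O rmax) → Policy Y O rmax) : Policy Y O rmax := fun l =>
  Q (sel (phaseIndex t l.length) (extend l)) (l.take (t (phaseIndex t l.length))) l

theorem phasePolicy_pre {t : ℕ → ℕ} (ht : StrictMono t) {sel : ℕ → Traj Y O rmax → ℕ}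
    (hsel : ∀ s, ∀ ω ω' : Traj Y O rmax, (∀ i < t s, ω i = ω' i) → sel s ω = sel s ω')
    (Q : ℕ → List (Cycle Y O rmax) → Policy Y O rmax) (ω : Traj Y O rmax) {s i : ℕ}
    (h1 : t s ≤ i) (h2 : i < t (s + 1)) :
    phasePolicy t sel Q (pre ω i) = Q (sel s ω) (pre ω (t s)) (pre ω i) := by
  have hext : sel s (extend (pre ω i)) = sel s ω :=
    hsel s _ _ fun j hj => getD_pre ω (hj.trans_le h1) _
  rw [phasePolicy, length_pre, phaseIndex_eq ht h1 h2, hext, take_pre ω h1]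

theorem P_phasePolicy_le [Fintype Y] [Fintype O] (ν : Environment Y O rmax) {t : ℕ → ℕ} (ht : StrictMono t)
    {sel : ℕ → Traj Y O rmax → ℕ}
    (hsel : ∀ s, ∀ ω ω' : Traj Y O rmax, (∀ i < t s, ω i = ω' i) → sel s ω = sel s ω')
    (Q : ℕ → List (Cycle Y O rmax) → Policy Y O rmax) {s e : ℕ} {B : Set (Traj Y O rmax)}
    (hB : ∀ ω ω' : Traj Y O rmax, (∀ i < t (s + 1), ω i = ω' i) → ω ∈ B → ω' ∈ B)
    {c : ℝ≥0∞}
    (hc : ∀ h : List (Cycle Y O rmax), h.length = t s → condProb ν (Q e h) h B ≤ c) :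
    ν.P (phasePolicy t sel Q) {ω | sel s ω = e ∧ ω ∈ B} ≤ c := by
  have := ν.P_prob (phasePolicy t sel Q)
  refine measure_le_of_cylSet_le (k := t s) fun ω => ?_
  by_cases he : sel s ω = e
  · calc _ ≤ ν.P (phasePolicy t sel Q) (cylSet (pre ω (t s)) ∩ B) :=
          measure_mono fun ω' h => ⟨h.1, h.2.2⟩
      _ = ν.P (phasePolicy t sel Q) (cylSet (pre ω (t s)))
            * condProb ν (Q e (pre ω (t s))) (pre ω (t s)) B := by
          refine P_cylSet_inter_eq ν (ht.monotone s.le_succ) hB fun ω' hω' i h1 h2 => ?_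
          have hagree := mem_cylSet_pre.1 hω'
          rw [phasePolicy_pre ht hsel Q ω' h1 h2, hsel s ω' ω hagree, he, pre_congr hagree]
      _ ≤ _ := by gcongr; exact hc _ (length_pre _ _)
  · have : cylSet (pre ω (t s)) ∩ {ω | sel s ω = e ∧ ω ∈ B} = ∅ := by
      ext ω'
      simp only [Set.mem_inter_iff, Set.mem_ofPred_eq, Set.mem_empty_iff_false, iff_false]
      rintro ⟨h1, h2, -⟩
      exact he (hsel s ω' ω (mem_cylSet_pre.1 h1) ▸ h2)
    rw [this, measure_empty]
    exact zero_le

end PhasePolicy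

theorem exists_near_optimal {R : ℝ} {U : ℕ → ℝ} (hU : ∀ i, U i ≤ R) (c : ℕ → ℕ) {v : ℝ}
    (hv : 0 < v) : ∃ e, ∀ i, U i - ((c i : ℝ) + i) / v ≤ U e - ((c e : ℝ) + e) / v + 1 / v := by
  have hbdd : BddAbove (Set.range fun i => U i - ((c i : ℝ) + i) / v) := by
    refine ⟨R, ?_⟩
    rintro _ ⟨i, rfl⟩
    have : 0 ≤ ((c i : ℝ) + i) / v := by positivity
    linarith [hU i]
  have hpos : 0 < 1 / v := by positivity
  obtain ⟨e, he⟩ := exists_lt_of_lt_ciSup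
    (sub_lt_self (⨆ i, U i - ((c i : ℝ) + i) / v) hpos)
  exact ⟨e, fun i => by linarith [le_ciSup hbdd i]⟩

section Selection

variable {Y O : Type} {rmax : ℕ}

theorem rew_nonneg (z : Cycle Y O rmax) : 0 ≤ rew z := Nat.cast_nonneg _

theorem rew_le (z : Cycle Y O rmax) : rew z ≤ rmax := by
  have := z.2.1.is_lt
  rw [rew]
  exact_mod_cast Nat.lt_succ_iff.1 this

/-- The rewards in phase `s` stay below the promise `U e` of expert `e`. -/
def PhaseFails (t N : ℕ → ℕ) (U : ℕ → ℝ) (s e : ℕ) (ω : Traj Y O rmax) : Prop :=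
  ∑ i ∈ Finset.Icc (t s) (t s + N s), rew (ω i) < ((N s : ℝ) + 1) * U e

theorem PhaseFails.congr {t N : ℕ → ℕ} (ht : ∀ s, t (s + 1) = t s + N s + 1) {U : ℕ → ℝ}
    {s e : ℕ} {ω ω' : Traj Y O rmax} (h : ∀ i < t (s + 1), ω i = ω' i)
    (hω : PhaseFails t N U s e ω) : PhaseFails t N U s e ω' := by
  have : ∑ i ∈ Finset.Icc (t s) (t s + N s), rew (ω i)
      = ∑ i ∈ Finset.Icc (t s) (t s + N s), rew (ω' i) :=
    Finset.sum_congr rfl fun i hi => by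
      rw [h i (by rw [ht]; have := (Finset.mem_Icc.1 hi).2; omega)]
  rwa [PhaseFails, this] at hω

/-- The number of failures of each expert before phase `s`, when `pick` selects the expert from the
previous failure counts. -/
def failureCount (t N : ℕ → ℕ) (U : ℕ → ℝ) (pick : ℕ → (ℕ → ℕ) → ℕ) (ω : Traj Y O rmax) :
    ℕ → ℕ → ℕ
  | 0 => 0
  | s + 1 => fun i => failureCount t N U pick ω s i +
      if i = pick s (failureCount t N U pick ω s) ∧
        PhaseFails t N U s (pick s (failureCount t N U pick ω s)) ω then 1 else 0

theorem failureCount_congr {t N : ℕ → ℕ} (ht : ∀ s, t (s + 1) = t s + N s + 1) (U : ℕ → ℝ)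
    (pick : ℕ → (ℕ → ℕ) → ℕ) {ω ω' : Traj Y O rmax} {s : ℕ} (h : ∀ i < t s, ω i = ω' i) :
    failureCount t N U pick ω s = failureCount t N U pick ω' s := by
  induction s with
  | zero => rfl
  | succ s ih =>
    have ih := ih fun i hi => h i (by rw [ht]; omega)
    have hfail : ∀ e, PhaseFails t N U s e ω ↔ PhaseFails t N U s e ω' := fun e =>
      ⟨PhaseFails.congr ht h, PhaseFails.congr ht fun i hi => (h i hi).symm⟩
    simp only [failureCount, ih, hfail]

theorem isFailureCount_failureCount (t N : ℕ → ℕ) (U : ℕ → ℝ) (pick : ℕ → (ℕ → ℕ) → ℕ)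
    (ω : Traj Y O rmax) :
    IsFailureCount (fun s => pick s (failureCount t N U pick ω s))
      (fun s => PhaseFails t N U s (pick s (failureCount t N U pick ω s)) ω)
      (failureCount t N U pick ω) := fun _ _ => rfl

end Selection

section Optimality

variable {Y O : Type} {rmax : ℕ}

theorem avg_le (ω : Traj Y O rmax) (m : ℕ) : avg ω m ≤ rmax := by
  refine div_le_of_le_mul₀ (by positivity) (by positivity) ?_
  have := Finset.sum_le_card_nsmul (range m) (fun i => rew (ω i)) rmax fun i _ => rew_le _
  rw [card_range, nsmul_eq_mul] at this
  linarith

theorem measurable_avg (m : ℕ) : Measurable fun ω : Traj Y O rmax => avg ω m :=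
  (Finset.measurable_sum _ fun i _ =>
    (measurable_from_top (f := rew)).comp (measurable_pi_apply i)).div_const _

theorem measurableSet_tendsto_avg (V : ℝ) :
    MeasurableSet {ω : Traj Y O rmax | Tendsto (avg ω) atTop (nhds V)} :=
  measurableSet_tendsto _ measurable_avg

theorem measurableSet_limsup_avg_le (V : ℝ) :
    MeasurableSet {ω : Traj Y O rmax | limsup (avg ω) atTop ≤ V} :=
  measurableSet_le (Measurable.limsup measurable_avg) measurable_const

variable [Fintype Y] [Fintype O]

theorem valueIs_iff {ν : Environment Y O rmax} {p : Policy Y O rmax} {V : ℝ} :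
    ValueIs ν p V ↔ ∀ᵐ ω ∂ν.P p, Tendsto (avg ω) atTop (nhds V) := by
  have := ν.P_prob p
  exact (mem_ae_iff_prob_eq_one (measurableSet_tendsto_avg V)).symm

theorem IsOptimalValue.ae_limsup_le {ν : Environment Y O rmax} {V : ℝ}
    (h : IsOptimalValue ν V) (q : Policy Y O rmax) :
    ∀ᵐ ω ∂ν.P q, limsup (avg ω) atTop ≤ V := by
  have := ν.P_prob q
  obtain ⟨-, -, h⟩ := h
  exact (mem_ae_iff_prob_eq_one (measurableSet_limsup_avg_le V)).2 (h q)

theorem IsOptimalValue.le {ν : Environment Y O rmax} {V W : ℝ} (hV : IsOptimalValue ν V)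
    (hW : IsOptimalValue ν W) : V ≤ W := by
  obtain ⟨q, hq, -⟩ := id hV
  have := ν.P_prob q
  obtain ⟨ω, h1, h2⟩ := ((valueIs_iff.1 hq).and (hW.ae_limsup_le q)).exists
  rwa [h1.limsup_eq] at h2

theorem IsOptimalValue.valueIs_of_ae_le {ν : Environment Y O rmax} {V : ℝ}
    (hV : IsOptimalValue ν V) {p : Policy Y O rmax}
    (h : ∀ᵐ ω ∂ν.P p, ∀ a < V, ∀ᶠ m in atTop, a < avg ω m) : ValueIs ν p V := by
  rw [valueIs_iff]
  filter_upwards [h, hV.ae_limsup_le p] with ω h1 h2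
  refine tendsto_order.2 ⟨h1, fun b hb => ?_⟩
  exact eventually_lt_of_limsup_lt (h2.trans_lt hb) ⟨rmax, eventually_map.2 <|
    Eventually.of_forall (avg_le ω)⟩

theorem ValueStableCore.target_mem_Icc {ν : Environment Y O rmax} {W : ℝ} {r : ℕ → ℝ}
    {d φ : ℕ → ℝ → ℝ} (h : ValueStableCore ν W r d φ) : W ∈ Set.Icc (0 : ℝ) rmax := by
  obtain ⟨hr, hW, -⟩ := h
  refine ⟨ge_of_tendsto' hW fun n => ?_, le_of_tendsto' hW fun n => ?_⟩
  · exact div_nonneg (Finset.sum_nonneg fun i _ => (hr i).1) (Nat.cast_nonneg n)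
  · refine div_le_of_le_mul₀ (by positivity) (by positivity) ?_
    have := Finset.sum_le_card_nsmul (range n) r rmax fun i _ => (hr i).2
    rw [card_range, nsmul_eq_mul] at this
    linarith

/-- The deviation at time `k` of `r` from its average `W`, together with the recovery loss. -/
def deviation (W : ℝ) (r : ℕ → ℝ) (d : ℕ → ℝ → ℝ) (ε : ℝ) (k : ℕ) : ℝ :=
  |d k ε| + |∑ i ∈ range k, r i - k * W|

theorem ValueStableCore.tendsto_deviation {ν : Environment Y O rmax} {W : ℝ} {r : ℕ → ℝ}
    {d φ : ℕ → ℝ → ℝ} (h : ValueStableCore ν W r d φ) {ε : ℝ} (hε : 0 < ε) :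
    Tendsto (fun k => deviation W r d ε k / k) atTop (nhds 0) := by
  obtain ⟨-, hW, hd, -⟩ := h
  have h1 := (hd ε hε).tendsto_div_nhds_zero.abs
  have h2 := (hW.sub_const W).abs
  rw [sub_self, abs_zero] at h2
  rw [abs_zero] at h1
  have h3 := h1.add h2
  rw [add_zero] at h3
  refine h3.congr' ?_
  filter_upwards [eventually_gt_atTop 0] with k hk
  have hk' : (0 : ℝ) < k := by exact_mod_cast hk
  rw [deviation, add_div, abs_div, abs_of_pos hk']
  congr 1
  rw [← abs_of_pos hk', ← abs_div, abs_of_pos hk', sub_div, mul_div_cancel_left₀ _ hk'.ne']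

/-- In long phases the policy recovering from the history fails the promise `W - 2 * ε` only with
probability `φ n ε`. -/
theorem condProb_phaseFails_le {ν : Environment Y O rmax} {W : ℝ} {r : ℕ → ℝ}
    {d φ : ℕ → ℝ → ℝ} {ε : ℝ} {t N : ℕ → ℕ} (ht : ∀ s, t (s + 1) = t s + N s + 1)
    {U : ℕ → ℝ} {s e : ℕ} (hU : U e = W - 2 * ε)
    (h1 : |deviation W r d ε (t s)| ≤ ε / 2 * (N s + 1))
    (h2 : |deviation W r d ε (t (s + 1))| ≤ ε / 2 * (N s + 1))
    (hε : 0 < ε) {h : List (Cycle Y O rmax)} (hh : h.length = t s) {p : Policy Y O rmax}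
    (hp : condProb ν p h {ω | d h.length ε + N s * ε <
        (∑ i ∈ Finset.Icc h.length (h.length + N s), r i)
          - ∑ i ∈ Finset.Icc h.length (h.length + N s), rew (ω i)}
      ≤ ENNReal.ofReal (φ (N s) ε)) :
    condProb ν p h {ω | PhaseFails t N U s e ω} ≤ ENNReal.ofReal (φ (N s) ε) := by
  refine le_trans (measure_mono fun ω hω => ?_) hp
  have hω : ∑ i ∈ Finset.Icc (t s) (t s + N s), rew (ω i) < ((N s : ℝ) + 1) * U e := hω
  rw [Set.mem_ofPred_eq, hh]
  have h3 := sum_range_add_sum_Icc r (t s) (N s)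
  rw [← ht] at h3
  have h4 := (le_abs_self _).trans h1
  have h5 := (le_abs_self _).trans h2
  rw [deviation] at h4 h5
  have h6 := le_abs_self (d (t s) ε)
  have h7 := le_abs_self (∑ i ∈ range (t s), r i - t s * W)
  have h8 := neg_abs_le (∑ i ∈ range (t (s + 1)), r i - t (s + 1) * W)
  have h9 := abs_nonneg (d (t (s + 1)) ε)
  have hT : (t (s + 1) : ℝ) = t s + (N s + 1) := by rw [ht]; push_cast; ring
  rw [hU] at hω
  rw [hT] at h8
  rw [hT] at h5
  nlinarith

end Optimality

/-- **Theorem 1 (value-stable ⇒ self-optimizing).**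
For any countable class `C` of value-stable environments, there exists a policy which is
self-optimizing for `C`: it attains `V(ν,p) = V*_ν` with probability 1 for every `ν ∈ C`. -/
theorem valueStable_selfOptimizing {Y O : Type} [Fintype Y] [Fintype O]
    [Nonempty Y] [Nonempty O] {rmax : ℕ}
    (C : Set (Environment Y O rmax)) (hcount : C.Countable)
    (hvs : ∀ ν ∈ C, ValueStable ν) :
    ∃ p : Policy Y O rmax, SelfOptimizing p C := by
  rcases C.eq_empty_or_nonempty with rfl | hne
  · exact ⟨fun _ => Classical.arbitrary Y, fun ν hν => absurd hν (Set.notMem_empty ν)⟩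
  obtain ⟨f, rfl⟩ := hcount.exists_eq_range hne
  choose V r d φ hopt hcore using fun i => hvs (f i) ⟨i, rfl⟩
  choose Q hQ using fun i => (hcore i).2.2.2.2
  -- The expert `e` coding `(i, m)` follows `Q i` and promises the average reward `V i - 2 * ε e`.
  obtain ⟨ε, hε⟩ : ∃ ε : ℕ → ℝ, ∀ e, ε e = 1 / 2 * (1 / ((e.unpair.2 : ℝ) + 1)) := ⟨_, fun _ => rfl⟩
  have hεpos : ∀ e, 0 < ε e := fun e => by rw [hε]; positivity
  obtain ⟨U, hU⟩ : ∃ U : ℕ → ℝ, ∀ e, U e = V e.unpair.1 - 2 * ε e := ⟨_, fun _ => rfl⟩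
  have hUle : ∀ e, U e ≤ rmax := fun e => by
    rw [hU]
    linarith [(hcore e.unpair.1).target_mem_Icc.2, hεpos e]
  have hUge : ∀ e, -1 ≤ U e := fun e => by
    have h1 : 1 / ((e.unpair.2 : ℝ) + 1) ≤ 1 :=
      (div_le_one (by positivity)).2 (by linarith [Nat.cast_nonneg (α := ℝ) e.unpair.2])
    rw [hU, hε]
    linarith [(hcore e.unpair.1).target_mem_Icc.1]
  obtain ⟨t, N, ht0, ht, hN, hρ, hdev⟩ := exists_schedule
    (fun e => deviation (V e.unpair.1) (r e.unpair.1) (d e.unpair.1) (ε e))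
    fun e => (hcore e.unpair.1).tendsto_deviation (hεpos e)
  obtain ⟨w, hw, hw', hrate⟩ := exists_rate hρ
  choose pick hpick using fun (s : ℕ) (c : ℕ → ℕ) =>
    exists_near_optimal hUle c (v := (w s : ℝ) + 1) (by positivity)
  have htm : StrictMono t := strictMono_nat_of_lt_succ fun s => by rw [ht]; omega
  let sel : ℕ → Traj Y O rmax → ℕ := fun s ω => pick s (failureCount t N U pick ω s)
  have hsel : ∀ s, ∀ ω ω' : Traj Y O rmax, (∀ i < t s, ω i = ω' i) → sel s ω = sel s ω' :=
    fun s ω ω' h => congrArg (pick s) (failureCount_congr ht U pick h)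
  let p : Policy Y O rmax := phasePolicy t sel fun e => Q e.unpair.1
  have hfail : ∀ e, ∀ᵐ ω ∂(f e.unpair.1).P p,
      ∀ᶠ s in atTop, sel s ω = e → ¬ PhaseFails t N U s e ω := by
    intro e
    obtain ⟨S, hS⟩ := eventually_atTop.1 (hdev e (ε e / 2) (half_pos (hεpos e)))
    have hbound : ∀ s, (f e.unpair.1).P p {ω | S ≤ s ∧ sel s ω = e ∧ PhaseFails t N U s e ω}
        ≤ ENNReal.ofReal (φ e.unpair.1 (N s) (ε e)) := by
      intro s
      by_cases hs : S ≤ s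
      · refine (measure_mono fun ω hω => hω.2).trans (P_phasePolicy_le (f e.unpair.1) htm hsel _
          (B := {ω | PhaseFails t N U s e ω}) (fun ω ω' h => PhaseFails.congr ht h) fun h hh => ?_)
        exact condProb_phaseFails_le ht (hU e) (hS s hs).1 (hS s hs).2 (hεpos e) hh
          (hQ _ h (ε e) (hεpos e) (N s))
      · simp [hs]
    have hsum : Summable fun s => φ e.unpair.1 (N s) (ε e) :=
      ((hcore e.unpair.1).2.2.2.1 (ε e) (hεpos e)).comp_injective hN.injective
    have hzero := measure_setOfPred_frequently_eq_zero
      (ne_top_of_le_ne_top hsum.tsum_ofReal_ne_top (ENNReal.tsum_le_tsum hbound))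
    rw [← compl_mem_ae_iff] at hzero
    filter_upwards [hzero] with ω hω
    filter_upwards [not_frequently.1 hω, eventually_ge_atTop S] with s h1 h2 h3 h4
    exact h1 ⟨h2, h3, h4⟩
  refine ⟨p, ?_⟩
  rintro _ ⟨i, rfl⟩ W hW
  refine hW.valueIs_of_ae_le ?_
  have hall : ∀ᵐ ω ∂(f i).P p, ∀ m, ∀ᶠ s in atTop,
      sel s ω = Nat.pair i m → ¬ PhaseFails t N U s (Nat.pair i m) ω := by
    refine ae_all_iff.2 fun m => ?_
    have := hfail (Nat.pair i m)
    rwa [Nat.unpair_pair] at this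
  filter_upwards [hall] with ω hω a ha
  have haV : 0 < V i - a := sub_pos.2 (ha.trans_le (hW.le (hopt i)))
  obtain ⟨m, hm⟩ := exists_nat_one_div_lt (half_pos haV)
  have hUm : U (Nat.pair i m) = V i - 1 / ((m : ℝ) + 1) := by
    rw [hU, hε, Nat.unpair_pair]
    ring
  have hgame := eventually_le_sum_of_optimistic ht0 ht hN hw hw' hrate hUle hUge
    (fun i => rew_nonneg (ω i)) (isFailureCount_failureCount t N U pick ω)
    (fun s => hpick s _) (j := Nat.pair i m)
    ((hω m).mono fun s hs h => by
      rw [h]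
      exact hs h)
    (η := (V i - a) / 6 - 1 / ((m : ℝ) + 1) / 3) (by linarith)
  filter_upwards [hgame, eventually_gt_atTop 0] with n hn hn0
  have hn0' : (0 : ℝ) < n := by exact_mod_cast hn0
  rw [hUm] at hn
  rw [avg, lt_div_iff₀ hn0']
  refine lt_of_lt_of_le ?_ hn
  gcongr
  linarith

end RL
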